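/- Let P be a finite set of lattice sites, ω : P × P → ℝ a nonnegative symmetric weight function, λ > 0 a regularization parameter, c : P → ℝ nonnegative cell areas, f : P → ℝ fixed data, and α ∈ {1, 2}. Define the discrete TVLα functional F_α(u) = λ·Σ_{p ∈ P} c(p)·|u(p) − f(p)|^α + Σ_{(p,q) ∈ P×P} ω(p,q)·|u(p) − u(q)|. Then F_α is submodular: for all u, v : P → ℝ, F_α(u ∨ v) + F_α(u ∧ v) ≤ F_α(u) + F_α(v), where ∨ and ∧ denote pointwise maximum and minimum. -/

import Mathlib

/-- The discrete TVLα functional: regularization parameter `λ`, cell areas `c`,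
data `f`, exponent `α`, and discrete total variation with weights `ω`. -/
def TVLα (P : Type*) [Fintype P] (ω : P → P → ℝ) (lam : ℝ) (c : P → ℝ)
    (f : P → ℝ) (α : ℕ) (u : P → ℝ) : ℝ :=
  lam * ∑ p : P, c p * |u p - f p| ^ α +
    ∑ p : P, ∑ q : P, ω p q * |u p - u q|

/-- The distance `|x - y|` is submodular on `ℝ × ℝ`. -/
theorem abs_max_sub_max_add_abs_min_sub_min_le (a b x y : ℝ) :
    |max a x - max b y| + |min a x - min b y| ≤ |a - b| + |x - y| := by
  rcases le_total a x with h₁ | h₁ <;> rcases le_total b y with h₂ | h₂ <;>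
    simp only [h₁, h₂, max_eq_left, max_eq_right, min_eq_left, min_eq_right] <;> grind

/-- A separable functional is modular: it satisfies the submodularity inequality with equality. -/
theorem sum_max_add_sum_min {P : Type*} [Fintype P] (g : P → ℝ → ℝ) (u v : P → ℝ) :
    ∑ p, g p (max (u p) (v p)) + ∑ p, g p (min (u p) (v p)) =
      ∑ p, g p (u p) + ∑ p, g p (v p) := by
  simp only [← Finset.sum_add_distrib]
  refine Finset.sum_congr rfl fun p _ => ?_
  rcases le_total (u p) (v p) with h | h <;> simp [h, add_comm]

/-- The discrete total variation with nonnegative weights is submodular. -/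
theorem totalVariation_submodular {P : Type*} [Fintype P] (ω : P → P → ℝ)
    (hω : ∀ p q, 0 ≤ ω p q) (u v : P → ℝ) :
    ∑ p, ∑ q, ω p q * |max (u p) (v p) - max (u q) (v q)| +
        ∑ p, ∑ q, ω p q * |min (u p) (v p) - min (u q) (v q)| ≤
      ∑ p, ∑ q, ω p q * |u p - u q| + ∑ p, ∑ q, ω p q * |v p - v q| := by
  simp only [← Finset.sum_add_distrib, ← mul_add]
  exact Finset.sum_le_sum fun p _ => Finset.sum_le_sum fun q _ =>
    mul_le_mul_of_nonneg_left (abs_max_sub_max_add_abs_min_sub_min_le _ _ _ _) (hω p q)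

/-- The discrete TVLα functional (for `α ∈ {1, 2}`, with nonnegative symmetric
weights, positive regularization parameter and nonnegative cell areas) is
submodular: `F_α(u ∨ v) + F_α(u ∧ v) ≤ F_α(u) + F_α(v)` with pointwise maximum
and minimum. -/
theorem TVLα_submodular (P : Type*) [Fintype P] (ω : P → P → ℝ)
    (hω : ∀ p q, 0 ≤ ω p q) (hsym : ∀ p q, ω p q = ω q p)
    (lam : ℝ) (hlam : 0 < lam) (c : P → ℝ) (hc : ∀ p, 0 ≤ c p)
    (f : P → ℝ) (α : ℕ) (hα : α = 1 ∨ α = 2) (u v : P → ℝ) :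
    TVLα P ω lam c f α (fun p => max (u p) (v p)) +
      TVLα P ω lam c f α (fun p => min (u p) (v p)) ≤
    TVLα P ω lam c f α u + TVLα P ω lam c f α v := by
  have hdata := sum_max_add_sum_min (fun p t => c p * |t - f p| ^ α) u v
  have htv := totalVariation_submodular ω hω u v
  unfold TVLα
  linear_combination lam * hdata + htv
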